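/- arXiv:1311.4154 — 3 statements merged into one kernel-verified Lean document; each statement's English description precedes it below -/
import Mathlib

section
/- Let (x_m)_{m∈ℕ} be a bounded sequence in ℝ^n and let Ls(x_m) denote its set of cluster points. Suppose (y_k)_{k∈ℕ} is a sequence in ℝ^n such that each y_k belongs to the convex hull of {x_j : j ≥ k}, and y_k converges to some y ∈ ℝ^n. Then y belongs to the convex hull of Ls(x_m). -/
open Filter Topology Set

/-- In a finite-dimensional space, the convex hull of a compact set is compact. -/
theorem IsCompact.convexHull_of_finiteDimensional {E : Type*} [NormedAddCommGroup E]
    [NormedSpace ℝ E] [FiniteDimensional ℝ E] {s : Set E} (hs : IsCompact s) :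
    IsCompact (convexHull ℝ s) := by
  let d := Module.finrank ℝ E + 1
  have hull_eq : convexHull ℝ s = ⋃ m ∈ Set.Iic d,
      (fun p : (Fin m → ℝ) × (Fin m → E) => ∑ i, p.1 i • p.2 i) ''
        (stdSimplex ℝ (Fin m) ×ˢ Set.univ.pi fun _ => s) := by
    apply Set.Subset.antisymm
    · intro x hx
      obtain ⟨ι, _, z, w, hz, hind, hw, hw1, hx⟩ := eq_pos_convex_span_of_mem_convexHull hx
      let e := (Fintype.equivFin ι).symm
      have hcard : Fintype.card ι ≤ d :=
        hind.card_le_finrank_succ.trans (Nat.succ_le_succ (Submodule.finrank_le _))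
      refine Set.mem_biUnion (Set.mem_Iic.mpr hcard) ⟨(w ∘ e, z ∘ e), ⟨⟨?_, ?_⟩, ?_⟩, ?_⟩
      · exact fun i => (hw _).le
      · exact (Equiv.sum_comp e w).trans hw1
      · exact fun i _ => hz (Set.mem_range_self _)
      · exact (Equiv.sum_comp e fun i => w i • z i).trans hx
    · refine Set.iUnion₂_subset fun m _ => ?_
      rintro _ ⟨⟨w, z⟩, ⟨⟨hw, hw1⟩, hz⟩, rfl⟩
      exact (convex_convexHull ℝ s).sum_mem (fun i _ => hw i) hw1
        fun i hi => subset_convexHull ℝ s (hz i (Set.mem_univ i))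
  rw [hull_eq]
  refine (Set.finite_Iic d).isCompact_biUnion fun m _ => ?_
  exact ((isCompact_stdSimplex ℝ (Fin m)).prod (isCompact_univ_pi fun _ => hs)).image (by fun_prop)

/-- if `(x_m)` is a bounded sequence in `ℝⁿ`, `(y_k)` is a sequence with
`y_k ∈ co {x_j : j ≥ k}` for each `k`, and `y_k → y`, then `y` lies in the convex hull of
the set of cluster points of `(x_m)`. -/
theorem mem_convexHull_clusterPts_of_tendsto
    {n : ℕ} (x : ℕ → EuclideanSpace ℝ (Fin n)) (hbd : ∃ C : ℝ, ∀ m, ‖x m‖ ≤ C)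
    (y : ℕ → EuclideanSpace ℝ (Fin n))
    (hy : ∀ k, y k ∈ convexHull ℝ {z | ∃ j ≥ k, x j = z})
    (y₀ : EuclideanSpace ℝ (Fin n)) (hlim : Tendsto y atTop (nhds y₀)) :
    y₀ ∈ convexHull ℝ {z | MapClusterPt z atTop x} := by
  obtain ⟨C, hC⟩ := hbd
  have hball : ∀ m, x m ∈ Metric.closedBall 0 C := fun m => mem_closedBall_zero_iff.mpr (hC m)
  have hcompact : IsCompact {z | MapClusterPt z atTop x} :=
    (isCompact_closedBall 0 C).of_isClosed_subset isClosed_setOfPred_clusterPt fun z hz =>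
      Metric.isClosed_closedBall.mem_of_mapClusterPt hz (Eventually.of_forall hball)
  by_contra hy₀
  obtain ⟨f, u, hfu, huy⟩ := geometric_hahn_banach_closed_point (convex_convexHull ℝ _)
    hcompact.convexHull_of_finiteDimensional.isClosed hy₀
  have hev : ∀ᶠ m in atTop, f (x m) < u := by
    by_contra hfreq
    have hK : IsCompact (Metric.closedBall 0 C ∩ {z | u ≤ f z}) :=
      (isCompact_closedBall 0 C).inter_right (isClosed_le continuous_const f.continuous)
    obtain ⟨z, hz, hzx⟩ := hK.exists_mapClusterPt_of_frequently (f := x) (l := atTop)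
      ((not_eventually.mp hfreq).mono fun m hm => ⟨hball m, not_lt.mp hm⟩)
    exact (hfu z (subset_convexHull ℝ _ hzx)).not_ge hz.2
  obtain ⟨N, hN⟩ := eventually_atTop.mp hev
  have hyN : ∀ k ≥ N, f (y k) < u := fun k hk =>
    convexHull_min (t := {z | f z < u}) (by rintro _ ⟨j, hj, rfl⟩; exact hN j (hk.trans hj))
      (convex_halfSpace_lt f.toLinearMap.isLinear u) (hy k)
  exact huy.not_ge (le_of_tendsto ((f.continuous.tendsto y₀).comp hlim)
    (eventually_atTop.mpr ⟨N, fun k hk => (hyN k hk).le⟩))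
end

section
/- Let (T, 𝒯, λ) be a probability space and (φ_m)_{m∈ℕ} a sequence of measurable real-valued functions on T such that |φ_m(t)| ≤ 1 for λ-almost all t and all m, ∫_T φ_m² dλ = 1 for all m, and ∫_T φ_m φ_k dλ = 0 for all m ≠ k (i.e., (φ_m) is orthonormal in L²(λ)). Then for every λ-integrable function ψ : T → ℝ, ∫_T ψ φ_m dλ → 0 as m → ∞. -/
open MeasureTheory Filter Topology

/-- A consequence of Bessel's inequality: the inner products of a fixed vector with an orthonormal
sequence tend to zero. -/
theorem Orthonormal.tendsto_inner_zero {E : Type*} [NormedAddCommGroup E] [InnerProductSpace ℝ E]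
    {v : ℕ → E} (hv : Orthonormal ℝ v) (x : E) :
    Tendsto (fun m => inner ℝ (v m) x) atTop (𝓝 0) := by
  have h := (hv.inner_products_summable x).tendsto_atTop_zero
  rw [tendsto_zero_iff_norm_tendsto_zero]
  simpa [Real.sqrt_sq_eq_abs] using h.sqrt

theorem MeasureTheory.MemLp.inner_toLp_eq_integral_mul {T : Type*} [MeasurableSpace T]
    {μ : Measure T} {f g : T → ℝ} (hf : MemLp f 2 μ) (hg : MemLp g 2 μ) :
    inner ℝ (hf.toLp f) (hg.toLp g) = ∫ t, g t * f t ∂μ := by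
  rw [L2.inner_def]
  refine integral_congr_ae ?_
  filter_upwards [hf.coeFn_toLp, hg.coeFn_toLp] with t hft hgt
  simp [hft, hgt]

/-- Integrals against a uniformly bounded sequence that converge to zero for every
square-integrable function do so for every integrable function. -/
theorem MeasureTheory.tendsto_integral_mul_zero_of_memLp_two {T : Type*} [MeasurableSpace T]
    {μ : Measure T} [IsFiniteMeasure μ] {φ : ℕ → T → ℝ}
    (hmeas : ∀ m, AEStronglyMeasurable (φ m) μ) (hbd : ∀ m, ∀ᵐ t ∂μ, |φ m t| ≤ 1)
    (hL2 : ∀ g : T → ℝ, MemLp g 2 μ → Tendsto (fun m => ∫ t, g t * φ m t ∂μ) atTop (𝓝 0))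
    {ψ : T → ℝ} (hψ : Integrable ψ μ) :
    Tendsto (fun m => ∫ t, ψ t * φ m t ∂μ) atTop (𝓝 0) := by
  rw [Metric.tendsto_atTop]
  intro ε hε
  obtain ⟨g, hg, -⟩ := (memLp_one_iff_integrable.mpr hψ).exists_simpleFunc_eLpNorm_sub_lt
    ENNReal.one_ne_top (ENNReal.ofReal_pos.mpr (half_pos hε)).ne'
  have hgi : Integrable g μ := g.integrable_of_isFiniteMeasure
  have hdiff : Integrable (fun t => ψ t - g t) μ := hψ.sub hgi
  have hdist : ∫ t, ‖ψ t - g t‖ ∂μ < ε / 2 := by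
    rw [integral_norm_eq_lintegral_enorm hdiff.aestronglyMeasurable]
    rw [eLpNorm_one_eq_lintegral_enorm] at hg
    exact (ENNReal.lt_ofReal_iff_toReal_lt hg.ne_top).mp hg
  obtain ⟨N, hN⟩ := Metric.tendsto_atTop.mp
    (hL2 g (g.memLp_of_isFiniteMeasure 2 μ)) (ε / 2) (half_pos hε)
  refine ⟨N, fun m hm => ?_⟩
  have hmul : ∀ {f : T → ℝ}, Integrable f μ → Integrable (fun t => f t * φ m t) μ :=
    fun hf => hf.mul_bdd (hmeas m) (hbd m)
  have herr : ‖∫ t, (ψ t - g t) * φ m t ∂μ‖ ≤ ∫ t, ‖ψ t - g t‖ ∂μ := by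
    refine norm_integral_le_of_norm_le hdiff.norm ?_
    filter_upwards [hbd m] with t ht
    rw [norm_mul]
    exact mul_le_of_le_one_right (norm_nonneg _) ht
  have hsplit : ∫ t, ψ t * φ m t ∂μ
      = ∫ t, (ψ t - g t) * φ m t ∂μ + ∫ t, g t * φ m t ∂μ := by
    rw [← integral_add (hmul hdiff) (hmul hgi)]
    simp only [sub_mul, sub_add_cancel]
  have hNm := hN m hm
  rw [dist_zero_right] at hNm ⊢
  rw [hsplit]
  linarith [norm_add_le (∫ t, (ψ t - g t) * φ m t ∂μ) (∫ t, g t * φ m t ∂μ)]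

/-- Bessel-type lemma: if `(φ_m)` is an orthonormal sequence in `L²(λ)` of
measurable functions uniformly bounded by `1`, then `∫ ψ φ_m dλ → 0` for every integrable
`ψ`. -/
theorem tendsto_integral_mul_orthonormal_bounded
    {T : Type*} [mT : MeasurableSpace T] (μ : Measure T) [IsProbabilityMeasure μ]
    (φ : ℕ → T → ℝ) (hmeas : ∀ m, Measurable (φ m))
    (hbd : ∀ m, ∀ᵐ t ∂μ, |φ m t| ≤ 1)
    (hnorm : ∀ m, ∫ t, φ m t * φ m t ∂μ = 1)
    (horth : ∀ m k, m ≠ k → ∫ t, φ m t * φ k t ∂μ = 0) :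
    ∀ ψ : T → ℝ, Integrable ψ μ →
      Tendsto (fun m => ∫ t, ψ t * φ m t ∂μ) atTop (nhds 0) := by
  intro ψ hψ
  have hφ : ∀ m, MemLp (φ m) 2 μ :=
    fun m => MemLp.of_bound (hmeas m).aestronglyMeasurable 1 (hbd m)
  have hv : Orthonormal ℝ fun m => (hφ m).toLp (φ m) := by
    rw [orthonormal_iff_ite]
    intro m k
    rw [(hφ m).inner_toLp_eq_integral_mul (hφ k)]
    split_ifs with h
    · rw [h, hnorm]
    · exact horth k m (Ne.symm h)
  refine tendsto_integral_mul_zero_of_memLp_two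
    (fun m => (hmeas m).aestronglyMeasurable) hbd (fun g hg => ?_) hψ
  simpa only [(hφ _).inner_toLp_eq_integral_mul hg] using hv.tendsto_inner_zero (hg.toLp g)
end

section
/- Consider a Bayesian game with finite actions with players I = {1,…,n}. Let h = (h_1,…,h_n) be a pure strategy profile, and for each j define h̄_j : T_j → M(X_j) by h̄_j(t_j)({x_j}) = E^{λ_j}(1_{{h_j = x_j}} | 𝒢_j)(t_j) for each x_j ∈ X_j, where 𝒢_j is player j's inter-player information. Then for every player i and every x_i ∈ X_i, for λ_i-almost all t_i ∈ T_i: ∫_{T_{-i}} u_i(x_i, h_{-i}(t_{-i}), (t_i, t_{-i})) q(t_i, t_{-i}) λ_{-i}(dt_{-i}) = ∫_{T_{-i}} Σ_{x_{-i} ∈ X_{-i}} w_i((x_i, x_{-i}), (t_i, t_{-i})) ∏_{j ≠ i} h̄_j(t_j)({x_j}) λ_{-i}(dt_{-i}), where λ_{-i} = ⊗_{j≠i} λ_j. -/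
open MeasureTheory Filter Topology Set
open scoped ENNReal

noncomputable section

/-- `D` is a `𝒢`-atom of `𝒯` under `μ`. -/
def IsCondAtom {T : Type*} (mT G : MeasurableSpace T) (μ : @MeasureTheory.Measure T mT)
    (D : Set T) : Prop :=
  MeasurableSet[mT] D ∧ 0 < μ D ∧
    ∀ D₀ : Set T, MeasurableSet[mT] D₀ → D₀ ⊆ D →
      ∃ D₁ : Set T, MeasurableSet[G] D₁ ∧ μ (symmDiff D₀ (D₁ ∩ D)) = 0

/-- `𝒯` has no `𝒢`-atom under `μ`. -/
def HasNoCondAtom {T : Type*} (mT G : MeasurableSpace T) (μ : @MeasureTheory.Measure T mT) :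
    Prop :=
  ∀ D : Set T, ¬ IsCondAtom mT G μ D

/-- A measure is atomless if every measurable set of positive measure has a measurable
subset of strictly smaller positive measure. -/
def AtomlessMeasure {T : Type*} {mT : MeasurableSpace T} (μ : Measure T) : Prop :=
  ∀ A : Set T, MeasurableSet A → 0 < μ A →
    ∃ B : Set T, MeasurableSet B ∧ B ⊆ A ∧ 0 < μ B ∧ μ B < μ A

/-- The density weighted payoff `w_i(x, t) = u_i(x, t) * q(t)`. -/
def dwPayoff {n : ℕ} {T X : Fin n → Type*}
    (u : Fin n → (∀ i, X i) → (∀ i, T i) → ℝ) (q : (∀ i, T i) → ℝ)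
    (i : Fin n) (x : ∀ k, X k) (t : ∀ k, T k) : ℝ :=
  u i x t * q t

/-- Player `i`'s inter-player information `𝒢_i`: the σ-algebra on `T i` generated by the
maps `t_i ↦ w_j(x, (t_i, t_{-i}))` for all `j ≠ i`, action profiles `x` and `t_{-i}`. -/
def interInfo {n : ℕ} {T X : Fin n → Type*}
    (u : Fin n → (∀ i, X i) → (∀ i, T i) → ℝ) (q : (∀ i, T i) → ℝ) (i : Fin n) :
    MeasurableSpace (T i) :=
  ⨆ (j : Fin n) (_ : j ≠ i) (x : ∀ k, X k) (s : ∀ k, T k),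
    MeasurableSpace.comap (fun ti : T i => dwPayoff u q j x (Function.update s i ti))
      inferInstance

/-- A pure strategy is measurable: each action has a measurable preimage. -/
def IsPureStrategy {A B : Type*} [MeasurableSpace A] (f : A → B) : Prop :=
  ∀ b : B, MeasurableSet {a | f a = b}

/-- Player `i`'s expected payoff from a pure strategy profile `f`. -/
def purePayoff {n : ℕ} {T X : Fin n → Type*} [∀ i, MeasurableSpace (T i)]
    (lam : Measure (∀ i, T i)) (u : Fin n → (∀ i, X i) → (∀ i, T i) → ℝ)
    (f : ∀ i, T i → X i) (i : Fin n) : ℝ :=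
  ∫ t, u i (fun j => f j (t j)) t ∂lam

/-- `f` is a pure strategy equilibrium. -/
def IsPureEquilibrium {n : ℕ} {T X : Fin n → Type*} [∀ i, MeasurableSpace (T i)]
    (lam : Measure (∀ i, T i)) (u : Fin n → (∀ i, X i) → (∀ i, T i) → ℝ)
    (f : ∀ i, T i → X i) : Prop :=
  (∀ i, IsPureStrategy (f i)) ∧
    ∀ (i : Fin n) (g : T i → X i), IsPureStrategy g →
      purePayoff lam u (Function.update f i g) i ≤ purePayoff lam u f i

/-- Combine `t_i : T i` with `t_{-i}` into a full type profile. -/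
def combine {n : ℕ} {T : Fin n → Type*} (i : Fin n) (ti : T i)
    (s : ∀ j : {j : Fin n // j ≠ i}, T j.val) : ∀ j, T j :=
  fun j => if h : j = i then cast (congrArg T h.symm) ti else s ⟨j, h⟩

/-- Combine `x_i : X i` with `x_{-i}` into a full action profile. -/
def combineAct {n : ℕ} {X : Fin n → Type*} (i : Fin n) (xi : X i)
    (xs : ∀ j : {j : Fin n // j ≠ i}, X j.val) : ∀ j, X j :=
  fun j => if h : j = i then cast (congrArg X h.symm) xi else xs ⟨j, h⟩

section UpdateCoordinate

variable {ι : Type*} [Fintype ι] [DecidableEq ι] {T : ι → Type*}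
  {G : ∀ j, MeasurableSpace (T j)} [mT : ∀ j, MeasurableSpace (T j)] (μ : ∀ j, Measure (T j)) [∀ j, IsProbabilityMeasure (μ j)]

/-- Resampling one coordinate of a product of probability measures preserves the product. -/
lemma measurePreserving_update_pi (j : ι) :
    MeasurePreserving (fun p : (∀ k, T k) × T j => Function.update p.1 j p.2)
      ((Measure.pi μ).prod (μ j)) (Measure.pi μ) := by
  have hm : Measurable (fun p : (∀ k, T k) × T j => Function.update p.1 j p.2) :=
    measurable_update'
  refine ⟨hm, (Measure.pi_eq fun A hA => ?_).symm⟩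
  rw [Measure.map_apply hm (MeasurableSet.univ_pi hA)]
  have hpre : (fun p : (∀ k, T k) × T j => Function.update p.1 j p.2) ⁻¹' (univ.pi A)
      = (univ.pi (Function.update A j univ)) ×ˢ A j := by
    ext ⟨s, t⟩
    simp only [mem_preimage, mem_univ_pi, mem_prod]
    constructor
    · intro h
      refine ⟨fun k => ?_, by simpa using h j⟩
      by_cases hk : k = j
      · subst hk; simp
      · simpa [hk] using h k
    · rintro ⟨h, ht⟩ k
      by_cases hk : k = j
      · subst hk; simpa using ht
      · simpa [hk] using h k
  rw [hpre, Measure.prod_prod, Measure.pi_pi, ← Finset.prod_erase_mul _ _ (Finset.mem_univ j),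
    ← Finset.prod_erase_mul Finset.univ (fun k => μ k (A k)) (Finset.mem_univ j)]
  simp only [Function.update_self, measure_univ, mul_one]
  congr 1
  refine Finset.prod_congr rfl fun k hk => ?_
  rw [Function.update_of_ne (Finset.ne_of_mem_erase hk)]

lemma integrable_mul_comp_eval_of_bdd {F : (∀ k, T k) → ℝ} (hF : Integrable F (Measure.pi μ))
    (j : ι) {g : T j → ℝ} (hg : Measurable g) (hb : ∀ᵐ t ∂(μ j), |g t| ≤ 1) :
    Integrable (fun s => F s * g (s j)) (Measure.pi μ) := by
  refine hF.mul_bdd (c := 1) (hg.comp (measurable_pi_apply j)).aestronglyMeasurable ?_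
  exact (Measure.quasiMeasurePreserving_eval μ j).ae hb

/-- If `F` is `G j`-measurable in coordinate `j`, a bounded factor depending on that coordinate may
be replaced by its conditional expectation given `G j`. -/
lemma integral_mul_eval_eq_integral_mul_condExp {F : (∀ k, T k) → ℝ}
    (hF : Integrable F (Measure.pi μ)) (j : ι) (hG : G j ≤ mT j)
    (hFG : ∀ s, Measurable[G j] fun t => F (Function.update s j t))
    {g : T j → ℝ} (hg : Measurable g) (hb : ∀ t, |g t| ≤ 1) :
    ∫ s, F s * g (s j) ∂(Measure.pi μ)
      = ∫ s, F s * ((μ j)[g | G j]) (s j) ∂(Measure.pi μ) := by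
  have hmp := measurePreserving_update_pi μ j
  have hgi : Integrable g (μ j) :=
    Integrable.of_bound hg.aestronglyMeasurable 1 (ae_of_all _ hb)
  have hgm : Measurable ((μ j)[g | G j]) := stronglyMeasurable_condExp.measurable.mono hG le_rfl
  have hgb : ∀ᵐ t ∂(μ j), |((μ j)[g | G j]) t| ≤ 1 :=
    ae_bdd_abs_condExp_of_ae_bdd_abs (ae_of_all (μ j) hb)
  have key : ∀ e : T j → ℝ, Measurable e → (∀ᵐ t ∂(μ j), |e t| ≤ 1) →
      ∫ s, F s * e (s j) ∂(Measure.pi μ)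
        = ∫ s, ∫ t, F (Function.update s j t) * e t ∂(μ j) ∂(Measure.pi μ) := by
    intro e he heb
    have hi := integrable_mul_comp_eval_of_bdd μ hF j he heb
    have h1 := hmp.integrable_comp_of_integrable hi
    have h2 := integral_map hmp.measurable.aemeasurable
      (f := fun s => F s * e (s j)) (by rw [hmp.map_eq]; exact hi.aestronglyMeasurable)
    rw [hmp.map_eq] at h2
    rw [h2]
    simpa using integral_prod _ h1
  rw [key g hg (ae_of_all _ hb), key _ hgm hgb]
  refine integral_congr_ae ?_
  filter_upwards [(hmp.integrable_comp_of_integrable hF).prod_right_ae] with s hs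
  have hs' : Integrable (fun t => F (Function.update s j t)) (μ j) := hs
  have hprod : Integrable (fun t => F (Function.update s j t) * g t) (μ j) :=
    hs'.mul_bdd (c := 1) hg.aestronglyMeasurable (ae_of_all _ hb)
  rw [← integral_condExp hG (f := fun t => F (Function.update s j t) * g t)]
  exact integral_congr_ae
    (condExp_mul_of_stronglyMeasurable_left (hFG s).stronglyMeasurable hprod hgi)

lemma integrable_mul_prod_eval {f : (∀ k, T k) → ℝ} (hf : Integrable f (Measure.pi μ))
    {e : ∀ j, T j → ℝ} (he : ∀ j, Measurable (e j)) (hb : ∀ j, ∀ᵐ t ∂(μ j), |e j t| ≤ 1)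
    (S : Finset ι) : Integrable (fun s => f s * ∏ j ∈ S, e j (s j)) (Measure.pi μ) := by
  induction S using Finset.induction_on with
  | empty => simpa using hf
  | insert a S ha ih =>
    refine (integrable_mul_comp_eval_of_bdd μ ih a (he a) (hb a)).congr (ae_of_all _ fun s => ?_)
    simp only [Finset.prod_insert ha]
    ring

/-- If `f` is `G j`-measurable in each coordinate `j` separately, then bounded factors depending on
single coordinates may all be replaced by their conditional expectations. -/
lemma integral_mul_prod_eval_eq_integral_mul_prod_condExp {f : (∀ k, T k) → ℝ}
    (hf : Integrable f (Measure.pi μ)) (hG : ∀ j, G j ≤ mT j)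
    (hfG : ∀ j s, Measurable[G j] fun t => f (Function.update s j t))
    {g : ∀ j, T j → ℝ} (hg : ∀ j, Measurable (g j)) (hb : ∀ j t, |g j t| ≤ 1) :
    Integrable (fun s => f s * ∏ j, g j (s j)) (Measure.pi μ) ∧
    Integrable (fun s => f s * ∏ j, ((μ j)[g j | G j]) (s j)) (Measure.pi μ) ∧
    ∫ s, f s * ∏ j, g j (s j) ∂(Measure.pi μ)
      = ∫ s, f s * ∏ j, ((μ j)[g j | G j]) (s j) ∂(Measure.pi μ) := by
  have hgm : ∀ j, Measurable ((μ j)[g j | G j]) := fun j =>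
    stronglyMeasurable_condExp.measurable.mono (hG j) le_rfl
  have hgb : ∀ j, ∀ᵐ t ∂(μ j), |((μ j)[g j | G j]) t| ≤ 1 := fun j =>
    ae_bdd_abs_condExp_of_ae_bdd_abs (ae_of_all (μ j) (hb j))
  refine ⟨integrable_mul_prod_eval μ hf hg (fun j => ae_of_all _ (hb j)) _,
    integrable_mul_prod_eval μ hf hgm hgb _, ?_⟩
  suffices H : ∀ S : Finset ι, ∫ s, f s * ∏ j, g j (s j) ∂(Measure.pi μ)
      = ∫ s, f s * ∏ j, (if j ∈ S then (μ j)[g j | G j] else g j) (s j) ∂(Measure.pi μ) by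
    simpa using H Finset.univ
  intro S
  induction S using Finset.induction_on with
  | empty => simp
  | insert a S ha ih =>
    rw [ih]
    set e : ∀ j, T j → ℝ := fun j => if j ∈ S then (μ j)[g j | G j] else g j with he
    have hem : ∀ j, Measurable (e j) := fun j => by
      simp only [he]; split_ifs
      exacts [hgm j, hg j]
    have heb : ∀ j, ∀ᵐ t ∂(μ j), |e j t| ≤ 1 := fun j => by
      simp only [he]; split_ifs
      exacts [hgb j, ae_of_all _ (hb j)]
    have step := integral_mul_eval_eq_integral_mul_condExp μ
      (integrable_mul_prod_eval μ hf hem heb (Finset.univ.erase a)) a (hG a) (fun s => ?_)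
      (hg a) (hb a)
    · convert step using 3 with s s
      · rw [mul_assoc, ← Finset.prod_erase_mul _ _ (Finset.mem_univ a)]
        simp [he, ha]
      · rw [mul_assoc, ← Finset.prod_erase_mul _ _ (Finset.mem_univ a)]
        congr 2
        · refine Finset.prod_congr rfl fun k hk => ?_
          simp [he, Finset.ne_of_mem_erase hk]
        · simp
    · have hc : ∀ t, ∏ k ∈ Finset.univ.erase a, e k (Function.update s a t k)
          = ∏ k ∈ Finset.univ.erase a, e k (s k) := fun t =>
        Finset.prod_congr rfl fun k hk => by
          rw [Function.update_of_ne (Finset.ne_of_mem_erase hk)]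
      simp only [hc]
      exact (hfG a s).mul_const _

end UpdateCoordinate

section Combine

variable {n : ℕ} {T : Fin n → Type*}

@[simp] lemma combine_self (i : Fin n) (ti : T i) (s : ∀ j : {j : Fin n // j ≠ i}, T j.val) :
    combine i ti s i = ti := by
  simp [combine]

lemma combine_of_ne (i : Fin n) (ti : T i) (s : ∀ j : {j : Fin n // j ≠ i}, T j.val)
    {j : Fin n} (hj : j ≠ i) : combine i ti s j = s ⟨j, hj⟩ := by
  simp [combine, hj]

lemma combine_update (i : Fin n) (ti : T i) (s : ∀ j : {j : Fin n // j ≠ i}, T j.val)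
    (j : {j : Fin n // j ≠ i}) (t : T j.val) :
    combine i ti (Function.update s j t) = Function.update (combine i ti s) j.val t := by
  funext k
  by_cases hk : k = i
  · subst hk
    rw [Function.update_of_ne j.2.symm, combine_self, combine_self]
  · rw [combine_of_ne _ _ _ hk]
    by_cases hkj : k = j.val
    · subst hkj; simp
    · rw [Function.update_of_ne hkj, combine_of_ne _ _ _ hk,
        Function.update_of_ne (fun h => hkj (congrArg Subtype.val h))]

lemma measurePreserving_combine [∀ i, MeasurableSpace (T i)] (μ : ∀ i, Measure (T i))
    [∀ i, IsProbabilityMeasure (μ i)] (i : Fin n) :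
    MeasurePreserving
      (fun p : T i × (∀ j : {j : Fin n // j ≠ i}, T j.val) => combine i p.1 p.2)
      ((μ i).prod (Measure.pi fun j : {j : Fin n // j ≠ i} => μ j.val)) (Measure.pi μ) := by
  have hm : Measurable
      (fun p : T i × (∀ j : {j : Fin n // j ≠ i}, T j.val) => combine i p.1 p.2) := by
    refine measurable_pi_lambda _ fun k => ?_
    by_cases hk : k = i
    · subst hk
      simpa using measurable_fst
    · simp only [combine_of_ne _ _ _ hk]
      exact (measurable_pi_apply _).comp measurable_snd
  refine ⟨hm, (Measure.pi_eq fun A hA => ?_).symm⟩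
  rw [Measure.map_apply hm (MeasurableSet.univ_pi hA)]
  have hpre : (fun p : T i × (∀ j : {j : Fin n // j ≠ i}, T j.val) => combine i p.1 p.2) ⁻¹'
      (univ.pi A) = A i ×ˢ (univ.pi fun j : {j : Fin n // j ≠ i} => A j.val) := by
    ext ⟨t, s⟩
    simp only [mem_preimage, mem_univ_pi, mem_prod]
    constructor
    · intro h
      refine ⟨by simpa using h i, fun k => ?_⟩
      simpa [combine_of_ne _ _ _ k.2] using h k.val
    · rintro ⟨ht, h⟩ k
      by_cases hk : k = i
      · subst hk; simpa using ht
      · simpa [combine_of_ne _ _ _ hk] using h ⟨k, hk⟩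
  rw [hpre, Measure.prod_prod, Measure.pi_pi, ← Finset.mul_prod_erase _ _ (Finset.mem_univ i)]
  congr 1
  exact (Finset.prod_subtype (Finset.univ.erase i) (fun k => by simp) fun k => μ k (A k)).symm

end Combine

lemma interInfo_le {n : ℕ} {T X : Fin n → Type*} [mT : ∀ i, MeasurableSpace (T i)]
    {u : Fin n → (∀ i, X i) → (∀ i, T i) → ℝ} {q : (∀ i, T i) → ℝ}
    (hum : ∀ i x, Measurable (u i x)) (hqm : Measurable q) (i : Fin n) :
    interInfo u q i ≤ mT i := by
  refine iSup_le fun j => iSup_le fun _ => iSup_le fun x => iSup_le fun s => ?_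
  exact (((hum j x).mul hqm).comp (measurable_update s)).comap_le

lemma measurable_interInfo_dwPayoff {n : ℕ} {T X : Fin n → Type*}
    (u : Fin n → (∀ i, X i) → (∀ i, T i) → ℝ) (q : (∀ i, T i) → ℝ) {i j : Fin n} (hij : i ≠ j)
    (x : ∀ k, X k) (s : ∀ k, T k) :
    Measurable[interInfo u q j] fun t => dwPayoff u q i x (Function.update s j t) :=
  measurable_iff_comap_le.2 <|
    le_iSup_of_le i <| le_iSup_of_le hij <| le_iSup_of_le x <| le_iSup_of_le s le_rfl

/-- for a pure strategy profile `h`, letting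
`h̄_j(t_j)({x_j}) = E^{λ_j}(1_{{h_j = x_j}}|𝒢_j)(t_j)`, for every player `i` and action
`x_i`, for `λ_i`-almost all `t_i`,
`∫_{T_{-i}} u_i(x_i, h_{-i}(t_{-i}), t) q(t) dλ_{-i}
  = ∫_{T_{-i}} Σ_{x_{-i}} w_i((x_i, x_{-i}), t) ∏_{j ≠ i} h̄_j(t_j)({x_j}) dλ_{-i}`. -/
theorem bayesian_game_interim_payoff_eq_condexp_form
    (n : ℕ) (hn : 1 ≤ n) (T X : Fin n → Type)
    [mT : ∀ i, MeasurableSpace (T i)]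
    (hcg : ∀ i, MeasurableSpace.CountablyGenerated (T i))
    [∀ i, Fintype (X i)] [∀ i, Nonempty (X i)]
    (lamM : ∀ i, Measure (T i)) [∀ i, IsProbabilityMeasure (lamM i)]
    (hatomless : ∀ i, AtomlessMeasure (lamM i))
    (lam : Measure (∀ i, T i)) [IsProbabilityMeasure lam]
    (hmarg : ∀ i, lam.map (fun t => t i) = lamM i)
    (q : (∀ i, T i) → ℝ) (hqm : Measurable q) (hq0 : ∀ t, 0 ≤ q t)
    (hac : lam = (Measure.pi lamM).withDensity fun t => ENNReal.ofReal (q t))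
    (u : Fin n → (∀ i, X i) → (∀ i, T i) → ℝ)
    (hum : ∀ i x, Measurable (u i x))
    (hubd : ∃ h : (∀ i, T i) → ℝ, Integrable h lam ∧
      ∀ i x, ∀ᵐ t ∂lam, |u i x t| ≤ h t)
    (hstrat : ∀ j, T j → X j) (hstratm : ∀ j, IsPureStrategy (hstrat j)) :
    ∀ (i : Fin n) (xi : X i), ∀ᵐ ti ∂(lamM i),
      (∫ s, (u i (combineAct i xi fun j => hstrat j.val (s j)) (combine i ti s) *
          q (combine i ti s)) ∂(Measure.pi fun j : {j : Fin n // j ≠ i} => lamM j.val))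
      = ∫ s, (∑ xs : ∀ j : {j : Fin n // j ≠ i}, X j.val,
            dwPayoff u q i (combineAct i xi xs) (combine i ti s) *
              ∏ j : {j : Fin n // j ≠ i},
                ((lamM j.val)[Set.indicator {sj | hstrat j.val sj = xs j} (fun _ => (1 : ℝ))
                  | interInfo u q j.val]) (s j))
          ∂(Measure.pi fun j : {j : Fin n // j ≠ i} => lamM j.val) := by
  intro i xi
  have hint : ∀ x, Integrable (dwPayoff u q i x) (Measure.pi lamM) := by
    intro x
    obtain ⟨h, hh, hb⟩ := hubd
    have hu : Integrable (u i x) lam := hh.mono' (hum i x).aestronglyMeasurable (hb i x)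
    rw [hac, integrable_withDensity_iff hqm.ennreal_ofReal (by simp)] at hu
    refine hu.congr (ae_of_all _ fun t => ?_)
    simp [dwPayoff, ENNReal.toReal_ofReal (hq0 t)]
  have hsec : ∀ᵐ ti ∂(lamM i), ∀ xs : ∀ j : {j : Fin n // j ≠ i}, X j.val,
      Integrable (fun s => dwPayoff u q i (combineAct i xi xs) (combine i ti s))
        (Measure.pi fun j : {j : Fin n // j ≠ i} => lamM j.val) := by
    rw [ae_all_iff]
    intro xs
    exact ((measurePreserving_combine lamM i).integrable_comp_of_integrable
      (hint (combineAct i xi xs))).prod_right_ae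
  filter_upwards [hsec] with ti hti
  have key := fun xs : ∀ j : {j : Fin n // j ≠ i}, X j.val =>
    integral_mul_prod_eval_eq_integral_mul_prod_condExp
      (fun j : {j : Fin n // j ≠ i} => lamM j.val) (hti xs)
      (G := fun j => interInfo u q j.val) (fun j => interInfo_le hum hqm j.val)
      (fun j s => by
        simp only [combine_update]
        exact measurable_interInfo_dwPayoff u q j.2.symm _ _)
      (g := fun j => Set.indicator {sj | hstrat j.val sj = xs j} (fun _ => (1 : ℝ)))
      (fun j => measurable_const.indicator (hstratm j.val (xs j)))
      (fun j t => by
        by_cases ht : hstrat j.val t = xs j <;> simp [Set.indicator, ht])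
  rw [integral_finsetSum _ fun xs _ => (key xs).2.1,
    Finset.sum_congr rfl fun xs _ => (key xs).2.2.symm,
    ← integral_finsetSum _ fun xs _ => (key xs).1]
  refine integral_congr_ae (ae_of_all _ fun s => ?_)
  dsimp only
  rw [Finset.sum_eq_single fun j : {j : Fin n // j ≠ i} => hstrat j.val (s j)]
  · simp [dwPayoff]
  · intro xs _ hne
    obtain ⟨j, hj⟩ := Function.ne_iff.1 hne
    rw [Finset.prod_eq_zero (Finset.mem_univ j), mul_zero]
    simp [Set.indicator, Ne.symm hj]
  · simp
end
end
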